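/- Let q be a prime power, F a finite field with q^2 elements, 1 < d ≤ q, and G ∈ F[x_0,...,x_4] a nonzero homogeneous polynomial of degree d. If some plane of ℙ^4(F) is contained in V(G)(F) but no hyperplane of ℙ^4(F) is contained in V(G)(F), then |V(G)(F) ∩ V_3| ≤ (d−1)q^5 + (d−1)q^4 + dq^3 + dq^2 + 1; in particular |V(G)(F) ∩ V_3| < d(q^5 + q^2) + q^3 + 1. -/

import Mathlib

open MvPolynomial

noncomputable section

/-- The projective space ℙ⁴(F): 1-dimensional F-linear subspaces of F⁵. -/
abbrev P4 (F : Type) [Field F] := Projectivization F (Fin 5 → F)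

/-- The non-degenerate Hermitian threefold
    V₃ = {[x] ∈ ℙ⁴(F) : x₀^{q+1} + ⋯ + x₄^{q+1} = 0}. -/
def hermV3 (q : ℕ) (F : Type) [Field F] : Set (P4 F) :=
  {x | ∑ i, x.rep i ^ (q + 1) = 0}

/-- V(G)(F) = {[x] ∈ ℙ⁴(F) : G(x) = 0}, for G homogeneous this is well defined. -/
def VG {F : Type} [Field F] (G : MvPolynomial (Fin 5) F) : Set (P4 F) :=
  {x | eval x.rep G = 0}

/-- The set of points of ℙ⁴(F) contained in an F-linear subspace of F⁵ of dimension k. -/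
def IsLinSub (F : Type) [Field F] (k : ℕ) (S : Set (P4 F)) : Prop :=
  ∃ W : Submodule F (Fin 5 → F), Module.finrank F W = k ∧
    S = {x : P4 F | x.submodule ≤ W}

/-- A line of ℙ⁴(F). -/
def IsLine (F : Type) [Field F] (S : Set (P4 F)) : Prop := IsLinSub F 2 S

/-- A plane of ℙ⁴(F). -/
def IsPlane (F : Type) [Field F] (S : Set (P4 F)) : Prop := IsLinSub F 3 S

/-- A hyperplane of ℙ⁴(F). -/
def IsHyperplane (F : Type) [Field F] (S : Set (P4 F)) : Prop := IsLinSub F 4 S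

/-- The tangent hyperplane T_P(V₃) = {[x] : a₀^q x₀ + ⋯ + a₄^q x₄ = 0} where P = [a]. -/
def tangentHyp (q : ℕ) {F : Type} [Field F] (P : P4 F) : Set (P4 F) :=
  {x | ∑ i, P.rep i ^ q * x.rep i = 0}

/-- A subset of ℙ⁴(F) is a tangent hyperplane to V₃ if it equals T_P(V₃) for some P ∈ V₃. -/
def IsTangentHyp (q : ℕ) {F : Type} [Field F] (S : Set (P4 F)) : Prop :=
  ∃ P ∈ hermV3 q F, S = tangentHyp q P

/-- The monomial function `s ↦ s₀^u₀ s₁^u₁ s₂^u₂` on a set of points of affine 3-space. -/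
def monoFun {F : Type} [Field F] (S : Finset (Fin 3 → F)) (u : Fin 3 → ℕ) : S → F :=
  fun s => ∏ i, (s : Fin 3 → F) i ^ u i

theorem monoFun_add {F : Type} [Field F] (S : Finset (Fin 3 → F)) (u v : Fin 3 → ℕ) :
    monoFun S (u + v) = monoFun S u * monoFun S v := by
  funext s
  simp [monoFun, pow_add, Finset.prod_mul_distrib]

/-- The span of the monomial functions of weight less than `γ`. -/
def lowerSpan {F Γ : Type} [Field F] [AddCommMonoid Γ] [LinearOrder Γ]
    (S : Finset (Fin 3 → F)) (wt : (Fin 3 → ℕ) →+ Γ) (γ : Γ) : Submodule F (S → F) :=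
  Submodule.span F (monoFun S '' {u | wt u < γ})

theorem monoFun_mem_lowerSpan {F Γ : Type} [Field F] [AddCommMonoid Γ] [LinearOrder Γ]
    {S : Finset (Fin 3 → F)} {wt : (Fin 3 → ℕ) →+ Γ} {γ : Γ} {u : Fin 3 → ℕ} (h : wt u < γ) :
    monoFun S u ∈ lowerSpan S wt γ :=
  Submodule.subset_span ⟨u, h, rfl⟩

theorem monoFun_mul_mem_lowerSpan {F Γ : Type} [Field F] [AddCommMonoid Γ] [LinearOrder Γ]
    [IsOrderedCancelAddMonoid Γ] {S : Finset (Fin 3 → F)} {wt : (Fin 3 → ℕ) →+ Γ} {γ : Γ}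
    (v : Fin 3 → ℕ) {f : S → F} (hf : f ∈ lowerSpan S wt γ) :
    monoFun S v * f ∈ lowerSpan S wt (wt v + γ) := by
  induction hf using Submodule.span_induction with
  | mem x hx =>
    obtain ⟨u, hu, rfl⟩ := hx
    rw [← monoFun_add]
    refine monoFun_mem_lowerSpan ?_
    rw [map_add]
    exact add_lt_add_right hu _
  | zero => simp
  | add x y _ _ hx hy => rw [mul_add]; exact add_mem hx hy
  | smul a x _ hx => rw [mul_smul_comm]; exact Submodule.smul_mem _ _ hx

/-- Reduction of monomial functions to a footprint: the relation `hrel` rewrites `x₂^n` as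
a multiple of `x₀^m₁ x₁^m₂` up to lower weight, and `hlead` is a relation with leading
exponent `l`. -/
theorem monoFun_mem_of_footprint {F Γ : Type} [Field F] [Fintype F] [AddCommMonoid Γ]
    [LinearOrder Γ] [IsOrderedCancelAddMonoid Γ] [WellFoundedLT Γ]
    (S : Finset (Fin 3 → F)) (wt : (Fin 3 → ℕ) →+ Γ) (hpos : ∀ i, 0 < wt (Pi.single i 1))
    (n m₁ m₂ : ℕ) (hn : 0 < n) (hwt : wt ![0, 0, n] = wt ![m₁, m₂, 0])
    (c : F) (hc : c ≠ 0)
    (hrel : monoFun S ![0, 0, n] - c • monoFun S ![m₁, m₂, 0] ∈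
      lowerSpan S wt (wt ![m₁, m₂, 0]))
    (l : Fin 3 → ℕ) (hl : l 2 < n) (hlead : monoFun S l ∈ lowerSpan S wt (wt l))
    (T : Submodule F (S → F))
    (hT : ∀ u : Fin 3 → ℕ, u 0 < Fintype.card F → u 1 < Fintype.card F → u 2 < n → ¬ l ≤ u →
      ¬ (l 0 + m₁ ≤ u 0 ∧ l 1 + m₂ ≤ u 1) → monoFun S u ∈ T) (u : Fin 3 → ℕ) :
    monoFun S u ∈ T := by
  have hmul : ∀ v, monoFun S (v + ![0, 0, n]) - c • monoFun S (v + ![m₁, m₂, 0]) ∈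
      lowerSpan S wt (wt (v + ![m₁, m₂, 0])) := by
    intro v
    have := monoFun_mul_mem_lowerSpan v hrel
    rwa [mul_sub, mul_smul_comm, ← monoFun_add, ← monoFun_add, ← map_add] at this
  have hlmul : ∀ v, monoFun S (v + l) ∈ lowerSpan S wt (wt (v + l)) := by
    intro v
    have := monoFun_mul_mem_lowerSpan v hlead
    rwa [← monoFun_add, ← map_add] at this
  induction hγ : wt u using WellFoundedLT.induction generalizing u with
  | ind γ IH =>
  have hlow : lowerSpan S wt γ ≤ T := by
    refine Submodule.span_le.2 ?_
    rintro _ ⟨v, hv, rfl⟩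
    exact IH _ hv v rfl
  induction hk : u 2 using Nat.strong_induction_on generalizing u with
  | _ k IHk =>
  subst hk hγ
  by_cases h2 : n ≤ u 2
  · have hu : u = ![u 0, u 1, u 2 - n] + ![0, 0, n] := by
      funext i; fin_cases i <;> simp [h2]
    have hw : wt u = wt (![u 0, u 1, u 2 - n] + ![m₁, m₂, 0]) := by
      conv_lhs => rw [hu]
      rw [map_add, map_add, hwt]
    have h1 := hmul ![u 0, u 1, u 2 - n]
    rw [← hw, ← hu] at h1
    have h3 := IHk (u 2 - n) (by omega) (![u 0, u 1, u 2 - n] + ![m₁, m₂, 0]) hw.symm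
      (by simp)
    have := add_mem (hlow h1) (T.smul_mem c h3)
    simpa using this
  have hcard : ∀ i, Fintype.card F ≤ u i → monoFun S u ∈ T := by
    intro i hi
    have hQ : 1 < Fintype.card F := Fintype.one_lt_card
    set v : Fin 3 → ℕ := Function.update u i (u i - Fintype.card F) with hv
    have hu : u = Pi.single i (Fintype.card F) + v := by
      funext j
      by_cases hj : j = i
      · subst hj; simp [hv, hi]
      · simp [hv, hj]
    have e : monoFun S u = monoFun S (Pi.single i 1 + v) := by
      conv_lhs => rw [hu]
      rw [monoFun_add, monoFun_add]
      congr 1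
      funext s
      refine Finset.prod_congr rfl fun j _ => ?_
      by_cases hj : j = i
      · subst hj; simp [FiniteField.pow_card]
      · simp [hj]
    rw [e]
    refine IH _ ?_ _ rfl
    conv_rhs => rw [hu]
    rw [map_add, map_add]
    refine add_lt_add_left ?_ _
    have : (Pi.single i (Fintype.card F) : Fin 3 → ℕ) =
        Fintype.card F • (Pi.single i 1 : Fin 3 → ℕ) := by
      rw [← Pi.single_smul]; simp
    rw [this, map_nsmul]
    calc wt (Pi.single i 1) = 1 • wt (Pi.single i 1) := (one_nsmul _).symm
      _ < _ := nsmul_lt_nsmul_left (hpos i) hQ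
  by_cases h0 : Fintype.card F ≤ u 0
  · exact hcard 0 h0
  by_cases h1 : Fintype.card F ≤ u 1
  · exact hcard 1 h1
  by_cases hlu : l ≤ u
  · have := hlmul (u - l)
    rw [tsub_add_cancel_of_le hlu] at this
    exact hlow this
  by_cases hmu : l 0 + m₁ ≤ u 0 ∧ l 1 + m₂ ≤ u 1
  · obtain ⟨ha, hb⟩ := hmu
    have hu : u = ![u 0 - m₁, u 1 - m₂, u 2] + ![m₁, m₂, 0] := by
      funext i; fin_cases i <;> simp <;> omega
    have hr : ![u 0 - m₁, u 1 - m₂, u 2] + ![0, 0, n] =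
        ![u 0 - m₁ - l 0, u 1 - m₂ - l 1, u 2 + n - l 2] + l := by
      funext i; fin_cases i <;> simp <;> omega
    have h3 := hmul ![u 0 - m₁, u 1 - m₂, u 2]
    have h4 := hlmul ![u 0 - m₁ - l 0, u 1 - m₂ - l 1, u 2 + n - l 2]
    rw [← hr, map_add, hwt, ← map_add, ← hu] at h4
    rw [← hu] at h3
    have h5 := T.smul_mem c⁻¹ (sub_mem (hlow h4) (hlow h3))
    rwa [sub_sub_cancel, inv_smul_smul₀ hc] at h5
  exact hT u (by omega) (by omega) (by omega) hlu hmu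

theorem span_range_monoFun {F : Type} [Field F] [Fintype F] (S : Finset (Fin 3 → F)) :
    Submodule.span F (Set.range (monoFun S)) = ⊤ := by
  classical
  rw [eq_top_iff]
  intro f _
  obtain ⟨p, hp⟩ : ∃ p : MvPolynomial (Fin 3) F, ∀ s : S, eval (s : Fin 3 → F) p = f s := by
    have h := MvPolynomial.map_restrict_dom_evalₗ F (Fin 3)
    have : (fun x : Fin 3 → F => if hx : x ∈ S then f ⟨x, hx⟩ else 0) ∈
        (⊤ : Submodule F ((Fin 3 → F) → F)) := trivial
    rw [← h] at this
    obtain ⟨p, -, hp⟩ := this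
    refine ⟨p, fun s => ?_⟩
    have := congrFun hp s
    simpa using this
  have : f = ∑ u ∈ p.support, p.coeff u • monoFun S u := by
    funext s
    rw [← hp s, eval_eq']
    simp [monoFun]
  rw [this]
  exact Submodule.sum_mem _ fun u _ => Submodule.smul_mem _ _ (Submodule.subset_span ⟨_, rfl⟩)

/-- The footprint bound in the box `Q × Q × n`. -/
theorem card_le_of_footprint {F Γ : Type} [Field F] [Fintype F] [AddCommMonoid Γ]
    [LinearOrder Γ] [IsOrderedCancelAddMonoid Γ] [WellFoundedLT Γ]
    (S : Finset (Fin 3 → F)) (wt : (Fin 3 → ℕ) →+ Γ) (hpos : ∀ i, 0 < wt (Pi.single i 1))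
    (n m₁ m₂ : ℕ) (hn : 0 < n) (hwt : wt ![0, 0, n] = wt ![m₁, m₂, 0])
    (c : F) (hc : c ≠ 0)
    (hrel : monoFun S ![0, 0, n] - c • monoFun S ![m₁, m₂, 0] ∈
      lowerSpan S wt (wt ![m₁, m₂, 0]))
    (l : Fin 3 → ℕ) (hl : l 2 < n) (hlead : monoFun S l ∈ lowerSpan S wt (wt l))
    (h0 : l 0 + m₁ ≤ Fintype.card F) (h1 : l 1 + m₂ ≤ Fintype.card F) :
    S.card ≤ Fintype.card F * (n * (l 0 + l 1) + l 2 * (m₁ + m₂)) := by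
  classical
  set Q := Fintype.card F with hQ
  let box := Finset.range Q ×ˢ Finset.range Q ×ˢ Finset.range n
  let c₁ := Finset.Ico (l 0) Q ×ˢ Finset.Ico (l 1) Q ×ˢ Finset.Ico (l 2) n
  let c₂ := Finset.Ico (l 0 + m₁) Q ×ˢ Finset.Ico (l 1 + m₂) Q ×ˢ Finset.range (l 2)
  let B := box \ (c₁ ∪ c₂)
  let e : ℕ × ℕ × ℕ → (S → F) := fun t => monoFun S ![t.1, t.2.1, t.2.2]
  have hspan : Submodule.span F ((B.image e : Finset (S → F)) : Set (S → F)) = ⊤ := by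
    rw [eq_top_iff, ← span_range_monoFun S, Submodule.span_le]
    rintro _ ⟨u, rfl⟩
    refine monoFun_mem_of_footprint S wt hpos n m₁ m₂ hn hwt c hc hrel l hl hlead _ ?_ u
    intro u hu0 hu1 hu2 hlu hmu
    refine Submodule.subset_span ?_
    rw [Finset.coe_image]
    refine ⟨(u 0, u 1, u 2), ?_, ?_⟩
    · have : ¬ (l 0 ≤ u 0 ∧ l 1 ≤ u 1 ∧ l 2 ≤ u 2) := by
        rintro ⟨a, b, c⟩
        exact hlu fun i => by fin_cases i <;> assumption
      simp only [B, box, c₁, c₂, Finset.coe_sdiff, Set.mem_sdiff, Finset.mem_coe,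
        Finset.mem_product, Finset.mem_range, Finset.mem_union, Finset.mem_Ico]
      omega
    · simp only [e]
      congr 1
      funext i; fin_cases i <;> rfl
  have hS : S.card ≤ B.card := by
    have h := finrank_span_finset_le_card (R := F) (B.image e)
    rw [Set.finrank, hspan, finrank_top, Module.finrank_fintype_fun_eq_card, Fintype.card_coe] at h
    exact h.trans Finset.card_image_le
  have hdisj : Disjoint c₁ c₂ := by
    rw [Finset.disjoint_left]
    rintro ⟨i, j, k⟩ h h'
    simp only [c₁, c₂, Finset.mem_product, Finset.mem_range, Finset.mem_Ico] at h h'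
    omega
  have hsub : c₁ ∪ c₂ ⊆ box := by
    rintro ⟨i, j, k⟩ h
    simp only [box, c₁, c₂, Finset.mem_product, Finset.mem_range, Finset.mem_Ico,
      Finset.mem_union] at h ⊢
    omega
  have hB : B.card + (c₁.card + c₂.card) = box.card := by
    rw [← Finset.card_union_of_disjoint hdisj, Finset.card_sdiff_add_card_eq_card hsub]
  simp only [box, c₁, c₂, Finset.card_product, Finset.card_range, Nat.card_Ico] at hB
  obtain ⟨A', hA⟩ := Nat.exists_eq_add_of_le h0
  obtain ⟨B', hB'⟩ := Nat.exists_eq_add_of_le h1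
  obtain ⟨D, hD⟩ := Nat.exists_eq_add_of_le hl.le
  have e1 : Q - l 0 = m₁ + A' := by omega
  have e2 : Q - l 1 = m₂ + B' := by omega
  have e3 : n - l 2 = D := by omega
  have e4 : Q - (l 0 + m₁) = A' := by omega
  have e5 : Q - (l 1 + m₂) = B' := by omega
  rw [e1, e2, e3, e4, e5] at hB
  refine hS.trans ?_
  have key : Q * (Q * n) + (n * (l 0 * l 1) + l 2 * (m₁ * l 1 + m₂ * (l 0 + m₁))) =
      Q * (n * (l 0 + l 1) + l 2 * (m₁ + m₂)) +
        ((m₁ + A') * ((m₂ + B') * D) + A' * (B' * l 2)) := by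
    have hA' : (A' : ℤ) = Q - l 0 - m₁ := by omega
    have hB'' : (B' : ℤ) = Q - l 1 - m₂ := by omega
    have hD' : (D : ℤ) = n - l 2 := by omega
    zify
    rw [hA', hB'', hD']
    ring
  omega

/-- Bound for the zeros of a polynomial of degree at most `e` among points satisfying
a relation rewriting `x₂^n` as a multiple of `x₀^m₁ x₁^m₂` up to lower weight. -/
theorem card_le_of_relation {F Γ : Type} [Field F] [Fintype F] [AddCommMonoid Γ]
    [LinearOrder Γ] [IsOrderedCancelAddMonoid Γ] [WellFoundedLT Γ]
    (S : Finset (Fin 3 → F)) (wt : (Fin 3 → ℕ) →+ Γ) (hpos : ∀ i, 0 < wt (Pi.single i 1))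
    (n m₁ m₂ : ℕ) (hwt : wt ![0, 0, n] = wt ![m₁, m₂, 0])
    (hinj : ∀ u v : Fin 3 → ℕ, u 2 < n → v 2 < n → wt u = wt v → u = v)
    (c : F) (hc : c ≠ 0)
    (hrel : monoFun S ![0, 0, n] - c • monoFun S ![m₁, m₂, 0] ∈
      lowerSpan S wt (wt ![m₁, m₂, 0]))
    (g : MvPolynomial (Fin 3) F) (hg : g ≠ 0) (e : ℕ) (hdeg : g.totalDegree ≤ e) (hen : e < n)
    (hgS : ∀ s ∈ S, eval s g = 0) (N : ℕ) (hnN : n ≤ N) (hmN : m₁ + m₂ ≤ N)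
    (heN : e + N ≤ Fintype.card F) :
    S.card ≤ Fintype.card F * (N * e) := by
  classical
  have hsum : ∀ u ∈ g.support, u 0 + u 1 + u 2 ≤ e := by
    intro u hu
    have h := (le_totalDegree hu).trans hdeg
    rw [Finsupp.sum_fintype _ _ (fun _ => rfl), Fin.sum_univ_three] at h
    exact h
  obtain ⟨l, hl, hmax⟩ := Finset.exists_max_image g.support (fun u => wt u)
    (support_nonempty.2 hg)
  have hls := hsum l hl
  have hcoeff : g.coeff l ≠ 0 := mem_support_iff.1 hl
  have hlead : monoFun S l ∈ lowerSpan S wt (wt l) := by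
    have hz : ∑ u ∈ g.support, g.coeff u • monoFun S u = 0 := by
      funext s
      have := hgS s s.2
      rw [eval_eq'] at this
      simpa [monoFun] using this
    rw [← Finset.add_sum_erase _ _ hl] at hz
    have h2 : ∑ u ∈ g.support.erase l, g.coeff u • monoFun S u ∈ lowerSpan S wt (wt l) := by
      refine Submodule.sum_mem _ fun u hu => Submodule.smul_mem _ _ (monoFun_mem_lowerSpan ?_)
      rw [Finset.mem_erase] at hu
      refine lt_of_le_of_ne (hmax u hu.2) fun h => hu.1 ?_
      have hus := hsum u hu.2
      exact DFunLike.coe_injective (hinj u l (by omega) (by omega) h)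
    have h3 := Submodule.smul_mem _ (-(g.coeff l)⁻¹) h2
    rw [← neg_eq_of_add_eq_zero_right hz, smul_neg, neg_smul, neg_neg,
      inv_smul_smul₀ hcoeff] at h3
    exact h3
  refine (card_le_of_footprint S wt hpos n m₁ m₂ (by omega) hwt c hc hrel l (by omega) hlead
    (by omega) (by omega)).trans (Nat.mul_le_mul_left _ ?_)
  calc n * (l 0 + l 1) + l 2 * (m₁ + m₂) ≤ N * (l 0 + l 1) + l 2 * N := by gcongr
    _ = N * (l 0 + l 1 + l 2) := by ring
    _ ≤ N * e := by gcongr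

/-- A relation between monomial functions with two distinguished terms. -/
theorem sub_smul_mem_lowerSpan {F Γ ι : Type} [Field F] [AddCommMonoid Γ] [LinearOrder Γ]
    [Fintype ι] {S : Finset (Fin 3 → F)} {wt : (Fin 3 → ℕ) →+ Γ} {E : ι → Fin 3 → ℕ}
    {β : ι → F} (hsum : ∑ i, β i • monoFun S (E i) = 0) {i j : ι} (hij : i ≠ j) (hi : β i ≠ 0)
    (hlow : ∀ k, k ≠ i → k ≠ j → β k ≠ 0 → wt (E k) < wt (E j)) :
    monoFun S (E i) - (-(β i)⁻¹ * β j) • monoFun S (E j) ∈ lowerSpan S wt (wt (E j)) := by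
  classical
  rw [← Finset.add_sum_erase _ _ (Finset.mem_univ i),
    ← Finset.add_sum_erase _ _ (Finset.mem_erase.2 ⟨hij.symm, Finset.mem_univ j⟩)] at hsum
  have h : ∑ k ∈ (Finset.univ.erase i).erase j, β k • monoFun S (E k) ∈
      lowerSpan S wt (wt (E j)) := by
    refine Submodule.sum_mem _ fun k hk => ?_
    simp only [Finset.mem_erase, Finset.mem_univ, and_true] at hk
    by_cases h0 : β k = 0
    · simp [h0]
    · exact Submodule.smul_mem _ _ (monoFun_mem_lowerSpan (hlow k hk.2 hk.1 h0))
  have h3 := Submodule.smul_mem _ (-(β i)⁻¹) h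
  convert h3 using 1
  rw [eq_neg_of_add_eq_zero_right ((add_assoc _ _ _).trans hsum), smul_neg, smul_add, neg_smul,
    inv_smul_smul₀ hi, neg_mul, neg_smul, neg_smul, mul_smul]
  abel

theorem totalDegree_aeval_le {F σ τ : Type} [Field F] (f : σ → MvPolynomial τ F)
    (hf : ∀ i, (f i).totalDegree ≤ 1) (p : MvPolynomial σ F) :
    (aeval f p).totalDegree ≤ p.totalDegree := by
  rw [aeval_def, eval₂_eq]
  refine (totalDegree_finsetSum _ _).trans (Finset.sup_le fun u hu => ?_)
  refine (totalDegree_mul _ _).trans ?_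
  rw [algebraMap_eq, totalDegree_C, zero_add]
  refine (totalDegree_finsetProd _ _).trans ?_
  refine le_trans (Finset.sum_le_sum fun i _ => ?_) (le_totalDegree hu)
  refine (totalDegree_pow _ _).trans ?_
  simpa using Nat.mul_le_mul_left (u i) (hf i)

theorem eval_smul_of_isHomogeneous {F σ : Type} [Field F] [Fintype σ] {p : MvPolynomial σ F}
    {d : ℕ} (hp : p.IsHomogeneous d) (c : F) (x : σ → F) :
    eval (c • x) p = c ^ d * eval x p := by
  rw [eval_eq', eval_eq', Finset.mul_sum]
  refine Finset.sum_congr rfl fun u hu => ?_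
  have : ∑ i, u i = d := by
    have := hp (mem_support_iff.1 hu)
    rw [Finsupp.weight_apply, Finsupp.sum_fintype _ _ (by simp)] at this
    simpa using this
  simp only [Pi.smul_apply, smul_eq_mul, mul_pow, Finset.prod_mul_distrib,
    Finset.prod_pow_eq_pow_sum, this]
  ring

theorem eq_zero_of_totalDegree_lt_card {F σ : Type} [Field F] [Fintype F] [Fintype σ]
    {p : MvPolynomial σ F} (hp : p.totalDegree < Fintype.card F) (h : ∀ x, eval x p = 0) :
    p = 0 := by
  refine eq_zero_of_eval_eq_zero σ F p h ?_
  rw [mem_restrictDegree]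
  intro u hu i
  have h1 : u i ≤ p.degreeOf i := monomial_le_degreeOf i hu
  have := degreeOf_le_totalDegree p i
  omega

theorem X_dvd_of_eval_eq_zero {F σ : Type} [Field F] [Fintype F] [Fintype σ]
    {p : MvPolynomial σ F} (hp : p.totalDegree < Fintype.card F) (k : σ)
    (h : ∀ x : σ → F, x k = 0 → eval x p = 0) : X k ∣ p := by
  classical
  let f : σ → MvPolynomial σ F := Function.update X k 0
  have hdvd : ∀ r : MvPolynomial σ F, X k ∣ r - aeval f r := by
    intro r
    have : (Ideal.Quotient.mkₐ F (Ideal.span {(X k : MvPolynomial σ F)})).comp (aeval f) =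
        Ideal.Quotient.mkₐ F (Ideal.span {(X k : MvPolynomial σ F)}) := by
      ext i
      by_cases hi : i = k
      · subst hi
        simp [f]
      · simp [f, hi]
    have := AlgHom.congr_fun this r
    rw [AlgHom.comp_apply, Ideal.Quotient.mkₐ_eq_mk, eq_comm, Ideal.Quotient.eq,
      Ideal.mem_span_singleton] at this
    exact this
  have h0 : aeval f p = 0 := by
    refine eq_zero_of_totalDegree_lt_card ((totalDegree_aeval_le f ?_ p).trans_lt hp) ?_
    · intro i
      by_cases hi : i = k
      · subst hi; simp [f]
      · simp [f, hi]
    · intro x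
      have : eval x (aeval f p) = eval (Function.update x k 0) p := by
        rw [← coe_aeval_eq_eval, ← coe_aeval_eq_eval, RingHom.coe_coe, RingHom.coe_coe,
          ← AlgHom.comp_apply]
        congr 1
        ext i
        by_cases hi : i = k
        · subst hi; simp [f]
        · simp [f, hi]
      rw [this]
      exact h _ (by simp)
  have := hdvd p
  rwa [h0, sub_zero] at this

/-- If a homogeneous polynomial of degree `d`, not identically zero on the span of `b`, vanishes
on the subspace where the `k`-th coordinate is zero, then its zeros outside of that subspace and
with zeroth coordinate `1` are zeros of a nonzero polynomial of degree less than `d`. -/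
theorem exists_affine_factor {F : Type} [Field F] [Fintype F] {m d : ℕ}
    (hd : d + 1 < Fintype.card F) {G : MvPolynomial (Fin m) F} (hG : G.IsHomogeneous d)
    (b : Fin 4 → Fin m → F) (k : Fin 4)
    (hk : ∀ x : Fin 4 → F, x k = 0 → eval (∑ j, x j • b j) G = 0)
    (hne : ∃ x : Fin 4 → F, eval (∑ j, x j • b j) G ≠ 0) :
    ∃ g : MvPolynomial (Fin 3) F, g ≠ 0 ∧ g.totalDegree ≤ d - 1 ∧
      ∀ s : Fin 3 → F, (Fin.cons 1 s : Fin 4 → F) k ≠ 0 →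
        eval (∑ j, (Fin.cons 1 s : Fin 4 → F) j • b j) G = 0 → eval s g = 0 := by
  let f : Fin m → MvPolynomial (Fin 4) F := fun i => ∑ j, C (b j i) * X j
  have hf : ∀ i, (f i).IsHomogeneous 1 := fun i =>
    IsHomogeneous.sum _ _ _ fun j _ => by
      simpa using (isHomogeneous_C (Fin 4) (b j i)).mul (isHomogeneous_X F j)
  have hGh : (aeval f G).IsHomogeneous d := by simpa using hG.aeval f hf
  have heval : ∀ x, eval x (aeval f G) = eval (∑ j, x j • b j) G := by
    intro x
    rw [← coe_aeval_eq_eval, ← coe_aeval_eq_eval, RingHom.coe_coe, RingHom.coe_coe,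
      ← AlgHom.comp_apply]
    congr 1
    ext i
    simp [f, mul_comm]
  have hne0 : aeval f G ≠ 0 := by
    rintro h
    obtain ⟨x, hx⟩ := hne
    exact hx (by rw [← heval, h, map_zero])
  obtain ⟨G', hG'⟩ := X_dvd_of_eval_eq_zero (p := aeval f G)
    (by have := hGh.totalDegree_le; omega) k (fun x hx => by rw [heval]; exact hk x hx)
  have hG'0 : G' ≠ 0 := by rintro rfl; exact hne0 (by rw [hG', mul_zero])
  have hdeg : G'.totalDegree ≤ d - 1 := by
    have h := hGh.totalDegree hne0
    rw [hG', totalDegree_mul_of_isDomain (X_ne_zero k) hG'0, totalDegree_X] at h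
    omega
  have hev : ∀ s : Fin 3 → F, eval s (aeval (Fin.cons 1 X : Fin 4 → MvPolynomial (Fin 3) F) G') =
      eval (Fin.cons 1 s : Fin 4 → F) G' := by
    intro s
    rw [← coe_aeval_eq_eval, ← coe_aeval_eq_eval, RingHom.coe_coe, RingHom.coe_coe,
      ← AlgHom.comp_apply]
    congr 1
    ext i
    refine Fin.cases ?_ (fun i => ?_) i <;> simp
  refine ⟨aeval (Fin.cons 1 X : Fin 4 → MvPolynomial (Fin 3) F) G', ?_, ?_, ?_⟩
  · intro h
    have hz : X 0 * aeval f G = 0 := by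
      refine eq_zero_of_totalDegree_lt_card ?_ fun x => ?_
      · have h1 := hGh.totalDegree_le
        have h2 := totalDegree_mul (X 0) (aeval f G)
        rw [totalDegree_X] at h2
        omega
      · rw [map_mul, eval_X]
        by_cases hx : x 0 = 0
        · rw [hx, zero_mul]
        · have hx' : x = x 0 • (Fin.cons 1 (fun j => (x 0)⁻¹ * x (Fin.succ j)) : Fin 4 → F) := by
            funext i
            refine Fin.cases ?_ (fun i => ?_) i <;> simp [hx]
          rw [hx', eval_smul_of_isHomogeneous hGh, hG', map_mul, ← hev, h]
          simp
    exact mul_ne_zero (X_ne_zero 0) hne0 hz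
  · refine (totalDegree_aeval_le _ (fun i => ?_) _).trans hdeg
    refine Fin.cases ?_ (fun i => ?_) i <;> simp
  · intro s hs h0
    rw [← heval, hG', map_mul, eval_X] at h0
    rw [hev]
    exact (mul_eq_zero.1 h0).resolve_left hs

/-- The Hermitian form `∑ φ(uᵢ) vᵢ`, semilinear in the first variable. -/
def hermForm {F : Type} [Field F] (φ : F →+* F) {m : ℕ} :
    (Fin m → F) →ₛₗ[φ] (Fin m → F) →ₗ[F] F :=
  LinearMap.mk₂'ₛₗ φ (RingHom.id F) (fun u v => ∑ i, φ (u i) * v i)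
    (fun _ _ _ => by simp [add_mul, Finset.sum_add_distrib])
    (fun _ _ _ => by simp [Finset.mul_sum, mul_assoc])
    (fun _ _ _ => by simp [mul_add, Finset.sum_add_distrib])
    (fun _ _ _ => by simp [Finset.mul_sum, mul_left_comm])

theorem hermForm_apply {F : Type} [Field F] (φ : F →+* F) {m : ℕ} (u v : Fin m → F) :
    hermForm φ u v = ∑ i, φ (u i) * v i := rfl

/-- Exponents of the coordinate functions `1, x₀, x₁, x₂`. -/
def coordExp : Fin 4 → Fin 3 → ℕ := ![0, ![1, 0, 0], ![0, 1, 0], ![0, 0, 1]]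

theorem sum_hermForm_smul_monoFun {F : Type} [Field F] {q m : ℕ} {φ : F →+* F}
    (hφ : ∀ x, φ x = x ^ q) (b : Fin 4 → Fin m → F) (S : Finset (Fin 3 → F))
    (hS : ∀ s ∈ S, hermForm φ (∑ j, (Fin.cons 1 s : Fin 4 → F) j • b j)
      (∑ j, (Fin.cons 1 s : Fin 4 → F) j • b j) = 0) :
    ∑ p : Fin 4 × Fin 4, hermForm φ (b p.1) (b p.2) •
      monoFun S (q • coordExp p.1 + coordExp p.2) = 0 := by
  have hcoord : ∀ (i : Fin 4) (s : S), monoFun S (coordExp i) s =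
      (Fin.cons 1 (s : Fin 3 → F) : Fin 4 → F) i := by
    intro i s
    fin_cases i <;> simp [monoFun, coordExp, Fin.prod_univ_three] <;> rfl
  have hpow : ∀ (u : Fin 3 → ℕ), monoFun S (q • u) = monoFun S u ^ q := by
    intro u
    funext s
    simp [monoFun, Finset.prod_pow, mul_comm q, pow_mul]
  funext s
  have h := hS s s.2
  simp only [map_sum, map_smul, LinearMap.map_smulₛₗ, LinearMap.sum_apply, LinearMap.smul_apply,
    smul_eq_mul] at h
  rw [Fintype.sum_prod_type]
  simp only [Finset.sum_apply, Pi.smul_apply, smul_eq_mul, Pi.zero_apply, monoFun_add, hpow,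
    Pi.mul_apply, Pi.pow_apply, hcoord]
  rw [← h, Finset.sum_comm]
  refine Finset.sum_congr rfl fun i _ => ?_
  rw [Finset.mul_sum]
  refine Finset.sum_congr rfl fun j _ => ?_
  rw [hφ]
  ring

/-- The weight function with lexicographic values `(a u₀ + b u₁ + c u₂, a' u₀ + b' u₁ + c' u₂)`. -/
def lexWeight (a b c a' b' c' : ℕ) : (Fin 3 → ℕ) →+ ℕ ×ₗ ℕ where
  toFun u := toLex (a * u 0 + b * u 1 + c * u 2, a' * u 0 + b' * u 1 + c' * u 2)
  map_zero' := by simp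
  map_add' u v := by
    rw [← toLex_add]
    congr 1
    ext <;> simp <;> ring

theorem lexWeight_apply (a b c a' b' c' : ℕ) (u : Fin 3 → ℕ) : lexWeight a b c a' b' c' u =
    toLex (a * u 0 + b * u 1 + c * u 2, a' * u 0 + b' * u 1 + c' * u 2) := rfl

/-- Affine points of a Hermitian hypersurface section whose hyperplane at infinity is tangent at
the point `b 3`. -/
theorem card_le_of_tangent_at_infinity {F : Type} [Field F] [Fintype F] {q m d : ℕ}
    (hq : 2 ≤ q) (hF : Fintype.card F = q ^ 2) {φ : F →+* F} (hφ : ∀ x, φ x = x ^ q)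
    (hd : 0 < d) (hdq : d ≤ q) {G : MvPolynomial (Fin m) F} (hG : G.IsHomogeneous d)
    (b : Fin 4 → Fin m → F) (k : Fin 4)
    (hk : ∀ x : Fin 4 → F, x k = 0 → eval (∑ j, x j • b j) G = 0)
    (hne : ∃ x : Fin 4 → F, eval (∑ j, x j • b j) G ≠ 0)
    (h33 : hermForm φ (b 3) (b 3) = 0) (h31 : hermForm φ (b 3) (b 1) = 0)
    (h13 : hermForm φ (b 1) (b 3) = 0) (h32 : hermForm φ (b 3) (b 2) = 0)
    (h30 : hermForm φ (b 3) (b 0) ≠ 0) (h11 : hermForm φ (b 1) (b 1) ≠ 0)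
    (S : Finset (Fin 3 → F))
    (hSk : ∀ s ∈ S, (Fin.cons 1 s : Fin 4 → F) k ≠ 0)
    (hS : ∀ s ∈ S, hermForm φ (∑ j, (Fin.cons 1 s : Fin 4 → F) j • b j)
      (∑ j, (Fin.cons 1 s : Fin 4 → F) j • b j) = 0)
    (hSG : ∀ s ∈ S, eval (∑ j, (Fin.cons 1 s : Fin 4 → F) j • b j) G = 0) :
    S.card ≤ (d - 1) * (q ^ 3 + q ^ 2) := by
  have hq2 : 2 * q ≤ q ^ 2 := by nlinarith
  obtain ⟨g, hg0, hgd, hg⟩ := exists_affine_factor (by omega) hG b k hk hne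
  have e30 : q • coordExp 3 + coordExp 0 = ![0, 0, q] := by
    funext i; fin_cases i <;> simp [coordExp]
  have e11 : q • coordExp 1 + coordExp 1 = ![q + 1, 0, 0] := by
    funext i; fin_cases i <;> simp [coordExp]
  have hrel := sub_smul_mem_lowerSpan (wt := lexWeight q 0 (q + 1) 0 1 0)
    (sum_hermForm_smul_monoFun hφ b S hS)
    (i := (3, 0)) (j := (1, 1)) (by decide) h30 (by
      rintro ⟨i, j⟩ h1 h2 h3
      rw [lexWeight_apply, lexWeight_apply, Prod.Lex.toLex_lt_toLex]
      fin_cases i <;> fin_cases j <;>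
        first
        | exact absurd rfl h1
        | exact absurd rfl h2
        | exact absurd h33 h3
        | exact absurd h31 h3
        | exact absurd h13 h3
        | exact absurd h32 h3
        | (simp [coordExp]; try first | omega | nlinarith))
  simp only [e30, e11] at hrel
  have := card_le_of_relation S (lexWeight q 0 (q + 1) 0 1 0) ?_ q (q + 1) 0 ?_ ?_ _ ?_ hrel g hg0
    (d - 1) hgd (by omega) (fun s hs => hg s (hSk s hs) (hSG s hs)) (q + 1) (by omega) (by omega)
    (by omega)
  · rw [hF] at this
    exact this.trans (le_of_eq (by ring))
  · intro i
    change toLex (0, 0) < _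
    rw [lexWeight_apply, Prod.Lex.toLex_lt_toLex]
    fin_cases i <;> simp; all_goals omega
  · rw [lexWeight_apply, lexWeight_apply]
    simp [mul_comm]
  · intro u v hu hv h
    rw [lexWeight_apply, lexWeight_apply, toLex_inj, Prod.mk.injEq] at h
    obtain ⟨h1, h2⟩ := h
    have h3 : q * (u 0 + u 2) + u 2 = q * (v 0 + v 2) + v 2 := by linarith
    have e2 : u 2 = v 2 := by
      have := congrArg (· % q) h3
      simpa [Nat.mul_add_mod, Nat.mod_eq_of_lt hu, Nat.mod_eq_of_lt hv] using this
    rw [e2] at h1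
    have e0 : u 0 = v 0 := by
      have : q * u 0 = q * v 0 := by linarith
      exact Nat.eq_of_mul_eq_mul_left (by omega) this
    funext i; fin_cases i
    · exact e0
    · simpa using h2
    · exact e2
  · exact mul_ne_zero (neg_ne_zero.2 (inv_ne_zero h30)) h11

/-- Affine points of a Hermitian hypersurface section whose section at infinity is
a non-degenerate Hermitian curve. -/
theorem card_le_of_nondegenerate_at_infinity {F : Type} [Field F] [Fintype F] {q m d : ℕ}
    (hq : 2 ≤ q) (hF : Fintype.card F = q ^ 2) {φ : F →+* F} (hφ : ∀ x, φ x = x ^ q)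
    (hd : 0 < d) (hdq : d ≤ q) {G : MvPolynomial (Fin m) F} (hG : G.IsHomogeneous d)
    (b : Fin 4 → Fin m → F)
    (hk : ∀ x : Fin 4 → F, x 0 = 0 → eval (∑ j, x j • b j) G = 0)
    (hne : ∃ x : Fin 4 → F, eval (∑ j, x j • b j) G ≠ 0)
    (h22 : hermForm φ (b 2) (b 2) = 0) (h23 : hermForm φ (b 2) (b 3) = 0)
    (h32 : hermForm φ (b 3) (b 2) = 0) (h21 : hermForm φ (b 2) (b 1) ≠ 0)
    (h33 : hermForm φ (b 3) (b 3) ≠ 0)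
    (S : Finset (Fin 3 → F))
    (hS : ∀ s ∈ S, hermForm φ (∑ j, (Fin.cons 1 s : Fin 4 → F) j • b j)
      (∑ j, (Fin.cons 1 s : Fin 4 → F) j • b j) = 0)
    (hSG : ∀ s ∈ S, eval (∑ j, (Fin.cons 1 s : Fin 4 → F) j • b j) G = 0) :
    S.card ≤ (d - 1) * (q ^ 3 + q ^ 2) := by
  have hq2 : 2 * q ≤ q ^ 2 := by nlinarith
  obtain ⟨g, hg0, hgd, hg⟩ := exists_affine_factor (by omega) hG b 0 hk hne
  have e33 : q • coordExp 3 + coordExp 3 = ![0, 0, q + 1] := by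
    funext i; fin_cases i <;> simp [coordExp]
  have e21 : q • coordExp 2 + coordExp 1 = ![1, q, 0] := by
    funext i; fin_cases i <;> simp [coordExp]
  have hrel := sub_smul_mem_lowerSpan (wt := lexWeight 1 1 1 0 (q + 1) q)
    (sum_hermForm_smul_monoFun hφ b S hS)
    (i := (3, 3)) (j := (2, 1)) (by decide) h33 (by
      rintro ⟨i, j⟩ h1 h2 h3
      rw [lexWeight_apply, lexWeight_apply, Prod.Lex.toLex_lt_toLex]
      fin_cases i <;> fin_cases j <;>
        first
        | exact absurd rfl h1
        | exact absurd rfl h2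
        | exact absurd h22 h3
        | exact absurd h23 h3
        | exact absurd h32 h3
        | (simp [coordExp]; try first | omega | nlinarith | exact Or.inr ⟨by omega, by nlinarith⟩))
  simp only [e33, e21] at hrel
  have := card_le_of_relation S (lexWeight 1 1 1 0 (q + 1) q) ?_ (q + 1) 1 q ?_ ?_ _ ?_ hrel g hg0
    (d - 1) hgd (by omega) (fun s hs => hg s (by simp) (hSG s hs)) (q + 1) (by omega) (by omega)
    (by omega)
  · rw [hF] at this
    exact this.trans (le_of_eq (by ring))
  · intro i
    change toLex (0, 0) < _
    rw [lexWeight_apply, Prod.Lex.toLex_lt_toLex]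
    fin_cases i <;> simp
  · rw [lexWeight_apply, lexWeight_apply]
    simp [mul_comm, add_comm]
  · intro u v hu hv h
    rw [lexWeight_apply, lexWeight_apply, toLex_inj, Prod.mk.injEq] at h
    obtain ⟨h1, h2⟩ := h
    have e2 : u 2 = v 2 := by
      have h3 : (q + 1) * (u 1 + u 2) + v 2 = (q + 1) * (v 1 + v 2) + u 2 := by
        linarith
      have := congrArg (· % (q + 1)) h3
      simpa [Nat.mul_add_mod, Nat.mod_eq_of_lt hu, Nat.mod_eq_of_lt hv] using this.symm
    rw [e2] at h1 h2
    have e1 : u 1 = v 1 := by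
      have : (q + 1) * u 1 = (q + 1) * v 1 := by linarith
      exact Nat.eq_of_mul_eq_mul_left (by omega) this
    have e0 : u 0 = v 0 := by omega
    funext i; fin_cases i
    · exact e0
    · exact e1
    · exact e2
  · exact mul_ne_zero (neg_ne_zero.2 (inv_ne_zero h33)) h21

theorem hermForm_symm {F : Type} [Field F] {φ : F →+* F} (hφ : ∀ x, φ (φ x) = x) {m : ℕ}
    (u v : Fin m → F) : hermForm φ v u = φ (hermForm φ u v) := by
  simp [hermForm_apply, hφ, mul_comm]

theorem hermForm_eq_zero_comm {F : Type} [Field F] {φ : F →+* F} (hφ : ∀ x, φ (φ x) = x) {m : ℕ}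
    {u v : Fin m → F} (h : hermForm φ u v = 0) : hermForm φ v u = 0 := by
  rw [hermForm_symm hφ, h, map_zero]

theorem hermForm_smul_self_eq_zero_iff {F : Type} [Field F] {φ : F →+* F} {m : ℕ} {c : F}
    (hc : c ≠ 0) {u : Fin m → F} : hermForm φ (c • u) (c • u) = 0 ↔ hermForm φ u u = 0 := by
  simp [hc]

theorem exists_pow_succ_eq {F : Type} [Field F] [Fintype F] {q : ℕ} (hq : 2 ≤ q)
    (hF : Fintype.card F = q ^ 2) {c : F} (hc : c ^ q = c) : ∃ l : F, l ^ (q + 1) = c := by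
  classical
  by_cases h0 : c = 0
  · exact ⟨0, by simp [h0]⟩
  obtain ⟨g, hg⟩ := IsCyclic.exists_generator (α := Fˣ)
  have hord : orderOf g = (q + 1) * (q - 1) := by
    rw [orderOf_eq_card_of_forall_mem_zpowers hg, Nat.card_eq_fintype_card, Fintype.card_units, hF]
    simpa using Nat.sq_sub_sq q 1
  obtain ⟨k, hk⟩ := (isOfFinOrder_of_finite g).mem_powers_iff_mem_zpowers.2 (hg (Units.mk0 c h0))
  have h1 : g ^ (k * (q - 1)) = 1 := by
    have hk' : g ^ k = Units.mk0 c h0 := hk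
    rw [pow_mul, hk']
    ext
    have : c ^ (q - 1) * c = 1 * c := by
      rw [← pow_succ, Nat.sub_add_cancel (by omega), hc, one_mul]
    simpa using mul_right_cancel₀ h0 this
  have h2 := orderOf_dvd_of_pow_eq_one h1
  rw [hord] at h2
  obtain ⟨r, rfl⟩ := Nat.dvd_of_mul_dvd_mul_right (by omega) h2
  refine ⟨((g ^ r : Fˣ) : F), ?_⟩
  have := congrArg Units.val hk
  simp only [Units.val_mk0] at this
  rw [← this, ← Units.val_pow_eq_pow_val, ← pow_mul, mul_comm r]

theorem exists_trace_ne_zero {F : Type} [Field F] [Fintype F] {q : ℕ} (hq : 2 ≤ q)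
    (hF : Fintype.card F = q ^ 2) : ∃ x : F, x ^ q + x ≠ 0 := by
  classical
  by_contra! h
  obtain ⟨g, hg⟩ := IsCyclic.exists_generator (α := Fˣ)
  have hord : orderOf g = q ^ 2 - 1 := by
    rw [orderOf_eq_card_of_forall_mem_zpowers hg, Nat.card_eq_fintype_card, Fintype.card_units, hF]
  have h1 : ∀ x : F, x ^ q = -x := fun x => eq_neg_of_add_eq_zero_left (h x)
  have h2 : g ^ (2 * (q - 1)) = 1 := by
    ext
    have h3 : (g : F) ^ (q - 1) * g = -1 * g := by
      rw [← pow_succ, Nat.sub_add_cancel (by omega), h1, neg_one_mul]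
    have h4 := mul_right_cancel₀ g.ne_zero h3
    simp [mul_comm 2, pow_mul, h4]
  have h3 := Nat.le_of_dvd (by omega) (orderOf_dvd_of_pow_eq_one h2)
  rw [hord] at h3
  have : 2 * q ≤ q ^ 2 := by nlinarith
  omega

theorem hermForm_eq_zero_of_isotropic {F : Type} [Field F] [Fintype F] {q m : ℕ} (hq : 2 ≤ q)
    (hF : Fintype.card F = q ^ 2) {φ : F →+* F} (hφ : ∀ x, φ x = x ^ q)
    (hφφ : ∀ x, φ (φ x) = x) {W : Submodule F (Fin m → F)}
    (hW : ∀ w ∈ W, hermForm φ w w = 0) {u v : Fin m → F} (hu : u ∈ W) (hv : v ∈ W) :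
    hermForm φ u v = 0 := by
  by_contra h
  obtain ⟨x, hx⟩ := exists_trace_ne_zero hq hF
  obtain ⟨c, h4⟩ : ∃ c, c * hermForm φ u v = x := ⟨x / hermForm φ u v, div_mul_cancel₀ _ h⟩
  have h1 := hW _ (W.add_mem hu (W.smul_mem c hv))
  have h2 := hW u hu
  have h3 := hW v hv
  have h5 := hermForm_symm hφφ u v
  simp only [map_add, LinearMap.add_apply, LinearMap.map_smulₛₗ, map_smul, LinearMap.smul_apply,
    smul_eq_mul, h2, h3, h5] at h1
  have h6 : φ c * φ (hermForm φ u v) = x ^ q := by rw [← map_mul, h4, hφ]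
  exact hx (by linear_combination h1 - h4 - h6)

theorem finrank_inf_ker {F V : Type} [Field F] [AddCommGroup V] [Module F V]
    [FiniteDimensional F V] (W : Submodule F V) (f : V →ₗ[F] F) {w : V} (hw : w ∈ W)
    (hf : f w ≠ 0) : Module.finrank F ↥(W ⊓ LinearMap.ker f) + 1 = Module.finrank F W := by
  have h := LinearMap.finrank_range_add_finrank_ker (f.domRestrict W)
  have hr : LinearMap.range (f.domRestrict W) = ⊤ :=
    LinearMap.range_eq_top.2 (LinearMap.surjective fun h0 => hf (by
      simpa using LinearMap.congr_fun h0 ⟨w, hw⟩))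
  rw [hr, finrank_top, Module.finrank_self, LinearMap.ker_domRestrict,
    ← Submodule.finrank_map_subtype_eq, Submodule.map_comap_subtype] at h
  omega

theorem finrank_le_finrank_inf_ker {F V : Type} [Field F] [AddCommGroup V] [Module F V]
    [FiniteDimensional F V] (W : Submodule F V) (f : V →ₗ[F] F) :
    Module.finrank F W ≤ Module.finrank F ↥(W ⊓ LinearMap.ker f) + 1 := by
  by_cases h : ∃ w ∈ W, f w ≠ 0
  · obtain ⟨w, hw, hf⟩ := h
    exact (finrank_inf_ker W f hw hf).ge
  · push Not at h
    rw [inf_eq_left.2 fun w hw => h w hw]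
    omega

theorem eq_zero_of_hermForm_eq_zero {F : Type} [Field F] {φ : F →+* F} {m : ℕ} {u : Fin m → F}
    (h : hermForm φ u = 0) : u = 0 := by
  funext i
  have := LinearMap.congr_fun h (Pi.single i 1)
  rw [hermForm_apply, Finset.sum_eq_single i (by simp +contextual) (by simp)]
    at this
  simpa using this

theorem finrank_add_le_of_orthogonal {F : Type} [Field F] {φ : F →+* F}
    (hφ : ∀ x, φ (φ x) = x) {m k : ℕ} {u : Fin k → Fin m → F} (hu : LinearIndependent F u)
    {W : Submodule F (Fin m → F)} (hW : ∀ i, ∀ w ∈ W, hermForm φ (u i) w = 0) :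
    Module.finrank F W + k ≤ m := by
  have hli : LinearIndependent F fun i => hermForm φ (u i) :=
    hu.map_of_injective_injective φ (hermForm φ).toAddMonoidHom
      (fun r hr => (map_eq_zero φ).1 hr) (fun u h => eq_zero_of_hermForm_eq_zero h)
      (fun r u => by simp [hφ])
  let Φ : Subspace F (Module.Dual F (Fin m → F)) :=
    Submodule.span F (Set.range fun i => hermForm φ (u i))
  have h1 : Module.finrank F Φ = k := by
    rw [finrank_span_eq_card hli, Fintype.card_fin]
  have h2 := Subspace.finrank_add_finrank_dualCoannihilator_eq Φ
  have h3 : W ≤ Φ.dualCoannihilator := by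
    intro w hw
    rw [Submodule.mem_dualCoannihilator]
    intro f hf
    induction hf using Submodule.span_induction with
    | mem f hf => obtain ⟨i, rfl⟩ := hf; exact hW i w hw
    | zero => rfl
    | add f g _ _ hf hg => rw [LinearMap.add_apply, hf, hg, add_zero]
    | smul a f _ hf => rw [LinearMap.smul_apply, hf, smul_zero]
  have h4 := Submodule.finrank_mono h3
  rw [Module.finrank_fin_fun] at h2
  omega

theorem exists_hermForm_self_ne_zero {F : Type} [Field F] [Fintype F] {q m : ℕ} (hq : 2 ≤ q)
    (hF : Fintype.card F = q ^ 2) {φ : F →+* F} (hφ : ∀ x, φ x = x ^ q)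
    (hφφ : ∀ x, φ (φ x) = x) {W : Submodule F (Fin m → F)} (hW : m < 2 * Module.finrank F W) :
    ∃ w ∈ W, hermForm φ w w ≠ 0 := by
  by_contra! h
  let b := Module.finBasis F W
  have hb : LinearIndependent F fun i => (b i : Fin m → F) :=
    b.linearIndependent.map' W.subtype (Submodule.ker_subtype W)
  have := finrank_add_le_of_orthogonal hφφ hb (W := W) fun i w hw =>
    hermForm_eq_zero_of_isotropic hq hF hφ hφφ h (b i).2 hw
  omega

theorem exists_isotropic {F : Type} [Field F] [Fintype F] {q m : ℕ} (hq : 2 ≤ q)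
    (hF : Fintype.card F = q ^ 2) {φ : F →+* F} (hφ : ∀ x, φ x = x ^ q)
    (hφφ : ∀ x, φ (φ x) = x) {W : Submodule F (Fin m → F)} (hW : 2 ≤ Module.finrank F W) :
    ∃ w ∈ W, w ≠ 0 ∧ hermForm φ w w = 0 := by
  obtain ⟨e, he, he0⟩ := W.exists_mem_ne_zero_of_ne_bot (by rintro rfl; simp at hW)
  by_cases hQ : hermForm φ e e = 0
  · exact ⟨e, he, he0, hQ⟩
  have h1 := finrank_inf_ker W (hermForm φ e) he hQ
  obtain ⟨f, hf, hf0⟩ := (W ⊓ LinearMap.ker (hermForm φ e)).exists_mem_ne_zero_of_ne_bot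
    (by intro h; rw [h] at h1; simp at h1; omega)
  have hef : hermForm φ e f = 0 := hf.2
  have hfe := hermForm_eq_zero_comm hφφ hef
  obtain ⟨l, hl⟩ := exists_pow_succ_eq hq hF (c := -(hermForm φ f f / hermForm φ e e)) (by
    rw [← hφ, map_neg, map_div₀, ← hermForm_symm hφφ, ← hermForm_symm hφφ])
  refine ⟨l • e + f, W.add_mem (W.smul_mem l he) hf.1, ?_, ?_⟩
  · intro h
    have h2 := congrArg (hermForm φ e) h
    simp only [map_add, map_smul, hef, smul_eq_mul, map_zero, add_zero] at h2
    rw [(mul_eq_zero.1 h2).resolve_right hQ] at h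
    exact hf0 (by simpa using h)
  · simp only [map_add, LinearMap.add_apply, LinearMap.map_smulₛₗ, map_smul, LinearMap.smul_apply,
      smul_eq_mul, hef, hfe, hφ]
    have : l ^ (q + 1) * hermForm φ e e = -hermForm φ f f := by
      rw [hl]; field_simp
    rw [pow_succ] at this
    linear_combination this

theorem card_submodule {F : Type} [Field F] [Fintype F] {m : ℕ} (W : Submodule F (Fin m → F))
    {k : ℕ} (hW : Module.finrank F W = k) (S : Finset (Fin m → F)) (hS : ∀ v, v ∈ S ↔ v ∈ W) :
    S.card = Fintype.card F ^ k := by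
  classical
  rw [← hW, ← Module.card_eq_pow_finrank (K := F) (V := W), Fintype.card_of_subtype S hS]

theorem card_pow_eq_le {F : Type} [Field F] [Fintype F] [DecidableEq F] (n : ℕ) (hn : 0 < n)
    (c : F) : (Finset.univ.filter fun x : F => x ^ n = c).card ≤ n := by
  have : (Finset.univ.filter fun x : F => x ^ n = c) = Polynomial.nthRootsFinset n c := by
    ext x
    simp [Polynomial.mem_nthRootsFinset hn]
  rw [this, Polynomial.nthRootsFinset_def]
  exact (Multiset.toFinset_card_le _).trans (Polynomial.card_nthRoots n c)

/-- The number of isotropic vectors of a subspace of dimension three. -/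
theorem card_isotropic_le {F : Type} [Field F] [Fintype F] {q m : ℕ} (hq : 2 ≤ q)
    (hF : Fintype.card F = q ^ 2) {φ : F →+* F} (hφ : ∀ x, φ x = x ^ q)
    (hφφ : ∀ x, φ (φ x) = x) (hm : m < 6) {W : Submodule F (Fin m → F)}
    (hW : Module.finrank F W = 3) (Z : Finset (Fin m → F))
    (hZ : ∀ v ∈ Z, v ∈ W ∧ hermForm φ v v = 0) : Z.card + q ^ 3 ≤ q ^ 5 + q ^ 4 := by
  classical
  obtain ⟨T, hT, hQT⟩ := exists_hermForm_self_ne_zero hq hF hφ hφφ (W := W) (by omega)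
  have hU : Module.finrank F ↥(W ⊓ LinearMap.ker (hermForm φ T)) = 2 := by
    have := finrank_inf_ker W (hermForm φ T) hT hQT
    omega
  set U := W ⊓ LinearMap.ker (hermForm φ T) with hUdef
  let l : (Fin m → F) → F := fun v => hermForm φ T v / hermForm φ T T
  let p : (Fin m → F) → (Fin m → F) := fun v => v - l v • T
  have hlT : ∀ v, l v * hermForm φ T T = hermForm φ T v := fun v => div_mul_cancel₀ _ hQT
  have hpU : ∀ v ∈ W, p v ∈ U := fun v hv => by
    refine ⟨W.sub_mem hv (W.smul_mem _ hT), ?_⟩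
    change hermForm φ T (v - l v • T) = 0
    rw [map_sub, map_smul, smul_eq_mul, hlT, sub_self]
  have hvp : ∀ v, v = p v + l v • T := fun v => (sub_add_cancel _ _).symm
  have hQp : ∀ v ∈ W, hermForm φ v v =
      hermForm φ (p v) (p v) + l v ^ (q + 1) * hermForm φ T T := by
    intro v hv
    have h1 : hermForm φ T (p v) = 0 := (hpU v hv).2
    have h2 := hermForm_eq_zero_comm hφφ h1
    conv_lhs => rw [hvp v]
    simp only [map_add, LinearMap.add_apply, LinearMap.map_smulₛₗ, map_smul, LinearMap.smul_apply,
      smul_eq_mul, h1, h2, hφ]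
    ring
  let UF : Finset (Fin m → F) := Finset.univ.filter (· ∈ U)
  have hUF : UF.card = q ^ 4 := by
    rw [card_submodule U hU UF (by simp [UF]), hF]
    ring
  let I := UF.filter fun u => hermForm φ u u = 0
  let N := UF.filter fun u => ¬ hermForm φ u u = 0
  have hIN : I.card + N.card = UF.card := Finset.card_filter_add_card_filter_not _
  have hI : q ^ 2 ≤ I.card := by
    obtain ⟨w, hw, hw0, hQw⟩ := exists_isotropic hq hF hφ hφφ hU.ge
    rw [← hF, ← Finset.card_univ]
    refine Finset.card_le_card_of_injOn (fun c : F => c • w) (fun c _ => ?_)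
      (fun c _ c' _ h => smul_left_injective F hw0 h)
    simp [I, UF, hQw, U.smul_mem c hw]
  have h1 : (Z.filter fun v => hermForm φ (p v) (p v) = 0).card ≤ I.card := by
    refine Finset.card_le_card_of_injOn id (fun v hv => ?_) (fun _ _ _ _ h => h)
    obtain ⟨hvZ, hv⟩ := Finset.mem_filter.1 hv
    obtain ⟨hvW, hQ⟩ := hZ v hvZ
    rw [hQp v hvW, hv, zero_add] at hQ
    have hl : l v = 0 := by simpa using (mul_eq_zero.1 hQ).resolve_right hQT
    have hpv : v = p v := by simpa [hl] using hvp v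
    simp only [I, UF, id, Finset.coe_filter, Set.mem_ofPred_eq, Finset.mem_filter,
      Finset.mem_univ, true_and]
    rw [hpv]
    exact ⟨hpU v hvW, hv⟩
  have h2 : (Z.filter fun v => ¬ hermForm φ (p v) (p v) = 0).card ≤ (q + 1) * N.card := by
    refine Finset.card_le_mul_card_image_of_maps_to (f := p) (fun v hv => ?_) _ (fun u _ => ?_)
    · obtain ⟨hvZ, hv⟩ := Finset.mem_filter.1 hv
      simp only [N, UF, Finset.mem_filter, Finset.mem_univ, true_and]
      exact ⟨hpU v (hZ v hvZ).1, hv⟩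
    · refine le_trans (Finset.card_le_card_of_injOn l (t := Finset.univ.filter fun x : F =>
        x ^ (q + 1) = -(hermForm φ u u / hermForm φ T T)) (fun v hv => ?_)
        (fun v hv v' hv' h => ?_)) (card_pow_eq_le (q + 1) (by omega) _)
      · simp only [Finset.coe_filter, Finset.mem_filter, Set.mem_ofPred_eq] at hv
        obtain ⟨⟨hvZ, -⟩, rfl⟩ := hv
        obtain ⟨hvW, hQ⟩ := hZ v hvZ
        rw [hQp v hvW] at hQ
        simp only [Finset.coe_filter, Finset.mem_univ, true_and, Set.mem_ofPred_eq]
        field_simp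
        linear_combination hQ
      · simp only [Finset.coe_filter, Finset.mem_filter, Set.mem_ofPred_eq] at hv hv'
        rw [hvp v, hvp v', hv.2, hv'.2, h]
  have h3 := Finset.card_filter_add_card_filter_not (s := Z)
    (fun v => hermForm φ (p v) (p v) = 0)
  have h4 : q * q ^ 2 ≤ q * I.card := Nat.mul_le_mul_left q hI
  nlinarith

theorem card_le_of_scaled_param {F : Type} [Field F] [Fintype F] {m d N : ℕ} {φ : F →+* F}
    {G : MvPolynomial (Fin m) F} (hG : G.IsHomogeneous d) (b : Fin 4 → Fin m → F) (k : Fin 4)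
    (c : (Fin 3 → F) → F)
    (hN : ∀ S : Finset (Fin 3 → F), (∀ s ∈ S, (Fin.cons 1 s : Fin 4 → F) k ≠ 0) →
      (∀ s ∈ S, hermForm φ (∑ j, (Fin.cons 1 s : Fin 4 → F) j • b j)
        (∑ j, (Fin.cons 1 s : Fin 4 → F) j • b j) = 0) →
      (∀ s ∈ S, eval (∑ j, (Fin.cons 1 s : Fin 4 → F) j • b j) G = 0) → S.card ≤ N)
    (Z : Finset (Fin m → F))
    (hZ : ∀ v ∈ Z, hermForm φ v v = 0 ∧ eval v G = 0 ∧ ∃ s : Fin 3 → F,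
      (Fin.cons 1 s : Fin 4 → F) k ≠ 0 ∧ c s ≠ 0 ∧
        v = c s • ∑ j, (Fin.cons 1 s : Fin 4 → F) j • b j) :
    Z.card ≤ N := by
  classical
  let p : (Fin 3 → F) → (Fin m → F) := fun s => ∑ j, (Fin.cons 1 s : Fin 4 → F) j • b j
  let S : Finset (Fin 3 → F) := Finset.univ.filter fun s =>
    (Fin.cons 1 s : Fin 4 → F) k ≠ 0 ∧ hermForm φ (p s) (p s) = 0 ∧ eval (p s) G = 0
  have hS : ∀ s ∈ S, (Fin.cons 1 s : Fin 4 → F) k ≠ 0 ∧ hermForm φ (p s) (p s) = 0 ∧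
      eval (p s) G = 0 := fun s hs => (Finset.mem_filter.1 hs).2
  refine le_trans ?_ (hN S (fun s hs => (hS s hs).1) (fun s hs => (hS s hs).2.1)
    (fun s hs => (hS s hs).2.2))
  refine (Finset.card_le_card (t := S.image fun s => c s • p s) fun v hv => ?_).trans
    Finset.card_image_le
  obtain ⟨h1, h2, s, hs, hc, rfl⟩ := hZ v hv
  refine Finset.mem_image.2 ⟨s, Finset.mem_filter.2 ⟨Finset.mem_univ s, hs, ?_, ?_⟩, rfl⟩
  · exact (hermForm_smul_self_eq_zero_iff hc).1 h1
  · rw [eval_smul_of_isHomogeneous hG] at h2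
    exact (mul_eq_zero.1 h2).resolve_left (pow_ne_zero d hc)

theorem exists_coords {F V : Type} [Field F] [AddCommGroup V] [Module F V]
    [FiniteDimensional F V] {W : Submodule F V} (hW : Module.finrank F W = 3) {e : Fin 3 → V}
    (he : ∀ i, e i ∈ W) (hli : LinearIndependent F e) {w : V} (hw : w ∈ W) :
    ∃ x : Fin 3 → F, w = x 0 • e 0 + x 1 • e 1 + x 2 • e 2 := by
  have hsp : Submodule.span F (Set.range e) = W :=
    Submodule.eq_of_le_of_finrank_eq
      (Submodule.span_le.2 (by rintro _ ⟨i, rfl⟩; exact he i))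
      (by rw [finrank_span_eq_card hli, hW, Fintype.card_fin])
  rw [← hsp, Submodule.mem_span_range_iff_exists_fun] at hw
  obtain ⟨x, hx⟩ := hw
  exact ⟨x, by rw [← hx, Fin.sum_univ_three]⟩

theorem linearIndependent_fin_three {F V : Type} [Field F] [AddCommGroup V] [Module F V]
    {e : Fin 3 → V} (h : ∀ x y z : F, x • e 0 + y • e 1 + z • e 2 = 0 → x = 0 ∧ y = 0 ∧ z = 0) :
    LinearIndependent F e := by
  rw [Fintype.linearIndependent_iff]
  intro g hg
  rw [Fin.sum_univ_three] at hg
  obtain ⟨h0, h1, h2⟩ := h _ _ _ hg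
  intro i
  fin_cases i
  exacts [h0, h1, h2]

theorem finrank_span_singleton_sup {F V : Type} [Field F] [AddCommGroup V] [Module F V]
    [FiniteDimensional F V] (W : Submodule F V) {u : V} (hu : u ∉ W) :
    Module.finrank F ↥(Submodule.span F {u} ⊔ W) = Module.finrank F W + 1 := by
  have h0 : u ≠ 0 := by rintro rfl; exact hu W.zero_mem
  have hd : Submodule.span F {u} ⊓ W = ⊥ :=
    disjoint_iff.1 ((Submodule.disjoint_span_singleton' h0).2 hu).symm
  have := Submodule.finrank_sup_add_finrank_inf_eq (Submodule.span F {u}) W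
  rw [hd, finrank_bot, finrank_span_singleton h0] at this
  omega

theorem card_coset_le_of_frame {F : Type} [Field F] [Fintype F] {m d N : ℕ} {φ : F →+* F}
    {G : MvPolynomial (Fin m) F} (hG : G.IsHomogeneous d) {W : Submodule F (Fin m → F)}
    (hW : Module.finrank F W = 3) (hGW : ∀ w ∈ W, eval w G = 0) {u : Fin m → F}
    (hGu : ∃ v ∈ Submodule.span F {u} ⊔ W, eval v G ≠ 0) {e : Fin 3 → Fin m → F}
    (he : ∀ i, e i ∈ W) (hli : LinearIndependent F e)
    (hN : (∀ x : Fin 4 → F, x 0 = 0 →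
        eval (∑ j, x j • (Fin.cons u e : Fin 4 → Fin m → F) j) G = 0) →
      (∃ x : Fin 4 → F, eval (∑ j, x j • (Fin.cons u e : Fin 4 → Fin m → F) j) G ≠ 0) →
      ∀ S : Finset (Fin 3 → F), (∀ s ∈ S, (Fin.cons 1 s : Fin 4 → F) 0 ≠ 0) →
      (∀ s ∈ S, hermForm φ
        (∑ j, (Fin.cons 1 s : Fin 4 → F) j • (Fin.cons u e : Fin 4 → Fin m → F) j)
        (∑ j, (Fin.cons 1 s : Fin 4 → F) j • (Fin.cons u e : Fin 4 → Fin m → F) j) = 0) →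
      (∀ s ∈ S, eval
        (∑ j, (Fin.cons 1 s : Fin 4 → F) j • (Fin.cons u e : Fin 4 → Fin m → F) j) G = 0) →
      S.card ≤ N)
    (Z : Finset (Fin m → F))
    (hZ : ∀ v ∈ Z, v - u ∈ W ∧ hermForm φ v v = 0 ∧ eval v G = 0) : Z.card ≤ N := by
  refine card_le_of_scaled_param hG (Fin.cons u e) 0 (fun _ => 1) (hN ?_ ?_) Z fun v hv => ?_
  · intro x hx
    refine hGW _ (W.sum_mem fun j _ => ?_)
    refine Fin.cases ?_ (fun i => W.smul_mem _ (he i)) j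
    simp [hx]
  · obtain ⟨v, hv, hGv⟩ := hGu
    obtain ⟨a, ha, w, hw, rfl⟩ := Submodule.mem_sup.1 hv
    obtain ⟨c, rfl⟩ := Submodule.mem_span_singleton.1 ha
    obtain ⟨x, rfl⟩ := exists_coords hW he hli hw
    refine ⟨Fin.cons c x, ?_⟩
    simpa [Fin.sum_univ_succ, add_assoc] using hGv
  · obtain ⟨h1, h2, h3⟩ := hZ v hv
    obtain ⟨x, hx⟩ := exists_coords hW he hli h1
    refine ⟨h2, h3, x, by simp, one_ne_zero, ?_⟩
    rw [sub_eq_iff_eq_add'] at hx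
    rw [hx]
    simp [Fin.sum_univ_succ, add_assoc]

/-- The section of a coset of a three-dimensional subspace, whose point of perpendicularity is
not orthogonal to the coset. -/
theorem card_coset_le_of_radical {F : Type} [Field F] [Fintype F] {q d : ℕ} (hq : 2 ≤ q)
    (hF : Fintype.card F = q ^ 2) {φ : F →+* F} (hφ : ∀ x, φ x = x ^ q)
    (hφφ : ∀ x, φ (φ x) = x) (hd : 0 < d) (hdq : d ≤ q) {G : MvPolynomial (Fin 5) F}
    (hG : G.IsHomogeneous d) {W : Submodule F (Fin 5 → F)} (hW : Module.finrank F W = 3)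
    (hGW : ∀ w ∈ W, eval w G = 0) {u : Fin 5 → F}
    (hGu : ∃ v ∈ Submodule.span F {u} ⊔ W, eval v G ≠ 0)
    {R : Fin 5 → F} (hR : R ∈ W) (hRW : ∀ w ∈ W, hermForm φ R w = 0) (hRu : hermForm φ R u ≠ 0)
    (Z : Finset (Fin 5 → F))
    (hZ : ∀ v ∈ Z, v - u ∈ W ∧ hermForm φ v v = 0 ∧ eval v G = 0) :
    Z.card ≤ (d - 1) * (q ^ 3 + q ^ 2) := by
  obtain ⟨e, he, hQe⟩ := exists_hermForm_self_ne_zero hq hF hφ hφφ (W := W) (by omega)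
  have hR0 : R ≠ 0 := by rintro rfl; simp at hRu
  have heR : hermForm φ e R = 0 := hermForm_eq_zero_comm hφφ (hRW e he)
  obtain ⟨z, hz, hz'⟩ : ∃ z ∈ W, z ∉ Submodule.span F (Set.range ![e, R]) := by
    by_contra! h
    have h1 := Submodule.finrank_mono h
    have h2 := finrank_range_le_card (R := F) ![e, R]
    rw [Set.finrank, Fintype.card_fin] at h2
    omega
  have hli : LinearIndependent F ![e, z, R] := by
    refine linearIndependent_fin_three fun x y t h => ?_
    simp only [Matrix.cons_val] at h
    have hy : y = 0 := by
      by_contra hy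
      refine hz' ?_
      rw [Submodule.mem_span_range_iff_exists_fun]
      refine ⟨![-(y⁻¹ * x), -(y⁻¹ * t)], ?_⟩
      have hyz : y • z = -(x • e) - t • R := by linear_combination (exp := 1) h
      rw [← inv_smul_smul₀ hy z, hyz]
      simp [mul_smul, sub_eq_add_neg]
    subst hy
    have hx : x = 0 := by
      have := congrArg (hermForm φ e) h
      simpa [heR, hQe] using this
    subst hx
    exact ⟨rfl, rfl, by simpa [hR0] using h⟩
  exact card_coset_le_of_frame hG hW hGW hGu (by simp [Fin.forall_fin_succ, he, hz, hR]) hli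
    (fun hk hne => card_le_of_tangent_at_infinity hq hF hφ hd hdq hG _ 0 hk hne
      (hRW R hR) (hRW e he) heR (hRW z hz) hRu hQe) Z hZ

/-- The section of a coset of a three-dimensional subspace on which the form is
non-degenerate. -/
theorem card_coset_le_of_nondegenerate {F : Type} [Field F] [Fintype F] {q d : ℕ} (hq : 2 ≤ q)
    (hF : Fintype.card F = q ^ 2) {φ : F →+* F} (hφ : ∀ x, φ x = x ^ q)
    (hφφ : ∀ x, φ (φ x) = x) (hd : 0 < d) (hdq : d ≤ q) {G : MvPolynomial (Fin 5) F}
    (hG : G.IsHomogeneous d) {W : Submodule F (Fin 5 → F)} (hW : Module.finrank F W = 3)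
    (hGW : ∀ w ∈ W, eval w G = 0) {u : Fin 5 → F}
    (hGu : ∃ v ∈ Submodule.span F {u} ⊔ W, eval v G ≠ 0)
    (hrad : ∀ R ∈ W, (∀ w ∈ W, hermForm φ R w = 0) → R = 0)
    (Z : Finset (Fin 5 → F))
    (hZ : ∀ v ∈ Z, v - u ∈ W ∧ hermForm φ v v = 0 ∧ eval v G = 0) :
    Z.card ≤ (d - 1) * (q ^ 3 + q ^ 2) := by
  obtain ⟨f, hf, hf0, hQf⟩ := exists_isotropic hq hF hφ hφφ (W := W) (by omega)
  obtain ⟨e, he, hfe⟩ : ∃ e ∈ W, hermForm φ f e ≠ 0 := by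
    by_contra! h
    exact hf0 (hrad f hf h)
  have hD := finrank_inf_ker W (hermForm φ f) he hfe
  have hsplit : ∀ w ∈ W, ∃ c : F, ∃ t ∈ W ⊓ LinearMap.ker (hermForm φ f), w = c • e + t := by
    intro w hw
    refine ⟨hermForm φ f w / hermForm φ f e, w - (hermForm φ f w / hermForm φ f e) • e,
      ⟨W.sub_mem hw (W.smul_mem _ he), ?_⟩, by simp⟩
    change hermForm φ f (w - (hermForm φ f w / hermForm φ f e) • e) = 0
    rw [map_sub, map_smul, smul_eq_mul, div_mul_cancel₀ _ hfe, sub_self]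
  obtain ⟨g, hg, hQg⟩ : ∃ g ∈ W ⊓ LinearMap.ker (hermForm φ f), hermForm φ g g ≠ 0 := by
    by_contra! h
    have h1 := finrank_le_finrank_inf_ker (W ⊓ LinearMap.ker (hermForm φ f)) (hermForm φ e)
    obtain ⟨v, hv, hv0⟩ := (W ⊓ LinearMap.ker (hermForm φ f) ⊓
      LinearMap.ker (hermForm φ e)).exists_mem_ne_zero_of_ne_bot
      (by intro h2; rw [h2, finrank_bot] at h1; omega)
    refine hv0 (hrad v hv.1.1 fun w hw => ?_)
    obtain ⟨c, t, ht, rfl⟩ := hsplit w hw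
    have h2 : hermForm φ v e = 0 := hermForm_eq_zero_comm hφφ hv.2
    rw [map_add, map_smul, h2, smul_zero, zero_add]
    exact hermForm_eq_zero_of_isotropic hq hF hφ hφφ h hv.1 ht
  have hgW : g ∈ W := hg.1
  have hfg : hermForm φ f g = 0 := hg.2
  have hgf := hermForm_eq_zero_comm hφφ hfg
  have hli : LinearIndependent F ![e, f, g] := by
    refine linearIndependent_fin_three fun x y t h => ?_
    simp only [Matrix.cons_val] at h
    have hx : x = 0 := by
      have := congrArg (hermForm φ f) h
      simpa [hfg, hQf, hfe] using this
    subst hx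
    have ht : t = 0 := by
      have := congrArg (hermForm φ g) h
      simpa [hgf, hQg] using this
    subst ht
    exact ⟨rfl, by simpa [hf0] using h, rfl⟩
  exact card_coset_le_of_frame hG hW hGW hGu (by simp [Fin.forall_fin_succ, he, hf, hgW]) hli
    (fun hk hne S _ => card_le_of_nondegenerate_at_infinity hq hF hφ hd hdq hG _ hk hne
      hQf hfg hgf hfe hQg S) Z hZ

/-- The section of a coset of a three-dimensional subspace, whose span is tangent at a point of
the subspace. -/
theorem card_coset_le_of_tangent {F : Type} [Field F] [Fintype F] {q d : ℕ} (hq : 2 ≤ q)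
    (hF : Fintype.card F = q ^ 2) {φ : F →+* F} (hφ : ∀ x, φ x = x ^ q)
    (hφφ : ∀ x, φ (φ x) = x) (hd : 0 < d) (hdq : d ≤ q) {G : MvPolynomial (Fin 5) F}
    (hG : G.IsHomogeneous d) {W : Submodule F (Fin 5 → F)} (hW : Module.finrank F W = 3)
    (hGW : ∀ w ∈ W, eval w G = 0) {u : Fin 5 → F} (hu : u ∉ W)
    (hGu : ∃ v ∈ Submodule.span F {u} ⊔ W, eval v G ≠ 0)
    (hperp : ∀ R ∈ W, (∀ w ∈ W, hermForm φ R w = 0) → hermForm φ R u = 0)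
    {R : Fin 5 → F} (hR : R ∈ W) (hRW : ∀ w ∈ W, hermForm φ R w = 0) (hR0 : R ≠ 0)
    (Z : Finset (Fin 5 → F))
    (hZ : ∀ v ∈ Z, v - u ∈ W ∧ hermForm φ v v = 0 ∧ eval v G = 0) :
    Z.card ≤ (d - 1) * (q ^ 3 + q ^ 2) := by
  obtain ⟨f, hf⟩ := Module.Projective.exists_dual_ne_zero F hR0
  have h1 := finrank_inf_ker W f hR hf
  obtain ⟨P, hP, hP0, hQP⟩ := exists_isotropic hq hF hφ hφφ (W := W ⊓ LinearMap.ker f) (by omega)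
  have hPW : P ∈ W := hP.1
  have hfP : f P = 0 := hP.2
  obtain ⟨U, hU, hPU⟩ : ∃ U ∈ W, hermForm φ P U ≠ 0 := by
    by_contra! h
    have hli : LinearIndependent F ![R, P] := by
      rw [LinearIndependent.pair_iff]
      intro s t hst
      have hs : s = 0 := by
        have := congrArg f hst
        simpa [hfP, hf] using this
      subst hs
      exact ⟨rfl, by simpa [hP0] using hst⟩
    have h2 : ∀ S ∈ W, (∀ w ∈ W, hermForm φ S w = 0) →
        ∀ w ∈ Submodule.span F {u} ⊔ W, hermForm φ S w = 0 := by
      intro S hS hSW v hv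
      obtain ⟨a, ha, w, hw, rfl⟩ := Submodule.mem_sup.1 hv
      obtain ⟨c, rfl⟩ := Submodule.mem_span_singleton.1 ha
      rw [map_add, map_smul, hperp S hS hSW, hSW w hw, smul_zero, zero_add]
    have h3 := finrank_add_le_of_orthogonal hφφ hli (W := Submodule.span F {u} ⊔ W)
      (fun i => by fin_cases i; exacts [h2 R hR hRW, h2 P hPW h])
    rw [finrank_span_singleton_sup W hu] at h3
    omega
  set l := hermForm φ P u / hermForm φ P U with hl
  set T := u - l • U with hT
  have hTW : T ∉ W := fun h => hu (by simpa [hT] using W.add_mem h (W.smul_mem l hU))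
  have hPT : hermForm φ P T = 0 := by
    rw [hT, map_sub, map_smul, smul_eq_mul, hl, div_mul_cancel₀ _ hPU, sub_self]
  have hTP := hermForm_eq_zero_comm hφφ hPT
  have hRT : hermForm φ R T = 0 := by
    rw [hT, map_sub, map_smul, hperp R hR hRW, hRW U hU, smul_zero, sub_zero]
  have hTR := hermForm_eq_zero_comm hφφ hRT
  have hRP := hRW P hP.1
  have hPR := hermForm_eq_zero_comm hφφ hRP
  have hRR := hRW R hR
  have hQT : hermForm φ T T ≠ 0 := by
    intro hQT
    have hli : LinearIndependent F ![T, R, P] := by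
      refine linearIndependent_fin_three fun x y t h => ?_
      simp only [Matrix.cons_val] at h
      have hx : x = 0 := by
        by_contra hx
        refine hTW ?_
        have hxT : x • T = -(y • R) - t • P := by linear_combination (exp := 1) h
        rw [← inv_smul_smul₀ hx T, hxT]
        exact W.smul_mem _ (W.sub_mem (W.neg_mem (W.smul_mem _ hR)) (W.smul_mem _ hPW))
      subst hx
      have hy : y = 0 := by
        have := congrArg f h
        simpa [hfP, hf] using this
      subst hy
      exact ⟨rfl, rfl, by simpa [hP0] using h⟩
    have h3 := finrank_add_le_of_orthogonal hφφ hli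
      (W := Submodule.span F (Set.range ![T, R, P])) (fun i w hw => by
        obtain ⟨c, rfl⟩ := (Submodule.mem_span_range_iff_exists_fun F).1 hw
        fin_cases i <;>
          simp [Fin.sum_univ_succ, hQT, hTR, hTP, hRT, hRR, hRP, hPT, hPR, hQP])
    rw [finrank_span_eq_card hli, Fintype.card_fin] at h3
    omega
  have hli : LinearIndependent F ![U, R, P] := by
    refine linearIndependent_fin_three fun x y t h => ?_
    simp only [Matrix.cons_val] at h
    have hx : x = 0 := by
      have := congrArg (hermForm φ P) h
      simpa [hPR, hQP, hPU] using this
    subst hx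
    have hy : y = 0 := by
      have := congrArg f h
      simpa [hfP, hf] using this
    subst hy
    exact ⟨rfl, rfl, by simpa [hP0] using h⟩
  have hcoord : ∀ w ∈ W, ∃ x : Fin 3 → F, w = x 0 • U + x 1 • R + x 2 • P := fun w hw =>
    exists_coords hW (e := ![U, R, P]) (by simp [Fin.forall_fin_succ, hU, hR, hPW]) hli hw
  have huT : u = T + l • U := by simp [hT]
  refine card_le_of_scaled_param hG ![U, T, R, P] 1 (fun s => (s 0)⁻¹)
    (card_le_of_tangent_at_infinity hq hF hφ hd hdq hG ![U, T, R, P] 1 ?_ ?_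
      hQP hPT hTP hPR hPU hQT) Z fun v hv => ?_
  · intro x hx
    refine hGW _ (W.sum_mem fun j _ => ?_)
    fin_cases j
    · exact W.smul_mem _ hU
    · simp [hx]
    · exact W.smul_mem _ hR
    · exact W.smul_mem _ hPW
  · obtain ⟨v, hv, hGv⟩ := hGu
    obtain ⟨a, ha, w, hw, rfl⟩ := Submodule.mem_sup.1 hv
    obtain ⟨c, rfl⟩ := Submodule.mem_span_singleton.1 ha
    obtain ⟨x, rfl⟩ := hcoord w hw
    refine ⟨![c * l + x 0, c, x 1, x 2], ?_⟩
    have hsum : c • u + (x 0 • U + x 1 • R + x 2 • P) =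
        ∑ j, ![c * l + x 0, c, x 1, x 2] j • ![U, T, R, P] j := by
      rw [huT]
      simp [Fin.sum_univ_succ]
      module
    rwa [hsum] at hGv
  · obtain ⟨hvu, hQv, hGv⟩ := hZ v hv
    obtain ⟨x, hx⟩ := hcoord _ hvu
    have hvx : v = (x 0 + l) • U + T + x 1 • R + x 2 • P := by
      rw [sub_eq_iff_eq_add.1 hx, huT]
      module
    have ht : x 0 + l ≠ 0 := by
      intro ht
      rw [hvx, ht] at hQv
      simp [hTR, hTP, hRT, hRR, hRP, hPT, hPR, hQP] at hQv
      exact hQT hQv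
    refine ⟨hQv, hGv, ![(x 0 + l)⁻¹, (x 0 + l)⁻¹ * x 1, (x 0 + l)⁻¹ * x 2], ?_, ?_, ?_⟩
    · simpa using ht
    · simpa using ht
    · rw [hvx]
      simp [Fin.sum_univ_succ, smul_smul, ht]
      abel

theorem card_coset_le {F : Type} [Field F] [Fintype F] {q d : ℕ} (hq : 2 ≤ q)
    (hF : Fintype.card F = q ^ 2) {φ : F →+* F} (hφ : ∀ x, φ x = x ^ q)
    (hφφ : ∀ x, φ (φ x) = x) (hd : 0 < d) (hdq : d ≤ q) {G : MvPolynomial (Fin 5) F}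
    (hG : G.IsHomogeneous d) {W : Submodule F (Fin 5 → F)} (hW : Module.finrank F W = 3)
    (hGW : ∀ w ∈ W, eval w G = 0) {u : Fin 5 → F} (hu : u ∉ W)
    (hGu : ∃ v ∈ Submodule.span F {u} ⊔ W, eval v G ≠ 0) (Z : Finset (Fin 5 → F))
    (hZ : ∀ v ∈ Z, v - u ∈ W ∧ hermForm φ v v = 0 ∧ eval v G = 0) :
    Z.card ≤ (d - 1) * (q ^ 3 + q ^ 2) := by
  by_cases h1 : ∃ R ∈ W, (∀ w ∈ W, hermForm φ R w = 0) ∧ hermForm φ R u ≠ 0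
  · obtain ⟨R, hR, hRW, hRu⟩ := h1
    exact card_coset_le_of_radical hq hF hφ hφφ hd hdq hG hW hGW hGu hR hRW hRu Z hZ
  push Not at h1
  by_cases h2 : ∃ R ∈ W, (∀ w ∈ W, hermForm φ R w = 0) ∧ R ≠ 0
  · obtain ⟨R, hR, hRW, hR0⟩ := h2
    exact card_coset_le_of_tangent hq hF hφ hφφ hd hdq hG hW hGW hu hGu h1 hR hRW hR0 Z hZ
  push Not at h2
  exact card_coset_le_of_nondegenerate hq hF hφ hφφ hd hdq hG hW hGW hGu h2 Z hZ

theorem exists_frobenius {F : Type} [Field F] [Fintype F] {q : ℕ} (hq : IsPrimePow q)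
    (hF : Fintype.card F = q ^ 2) :
    ∃ φ : F →+* F, (∀ x, φ x = x ^ q) ∧ ∀ x, φ (φ x) = x := by
  obtain ⟨p, m, hp, hm, rfl⟩ := hq
  obtain ⟨p', hchar⟩ := CharP.exists F
  obtain ⟨n, hp', hn⟩ := FiniteField.card F p'
  have hpp : p = p' := by
    refine (Nat.prime_dvd_prime_iff_eq hp.nat_prime hp').1
      (hp.nat_prime.dvd_of_dvd_pow (n := (n : ℕ)) ?_)
    rw [← hn, hF, ← pow_mul]
    exact dvd_pow_self p (by omega)
  subst hpp
  have := Fact.mk hp.nat_prime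
  refine ⟨iterateFrobenius F p m, fun x => iterateFrobenius_def p m x, fun x => ?_⟩
  rw [iterateFrobenius_def, iterateFrobenius_def, ← pow_mul, ← sq, ← hF, FiniteField.pow_card]

/-- The number of common affine zeros of the Hermitian form and a polynomial vanishing on
a subspace of dimension three but on no subspace of dimension four. -/
theorem card_isotropic_zeros_le {F : Type} [Field F] [Fintype F] {q d : ℕ} (hq : 2 ≤ q)
    (hF : Fintype.card F = q ^ 2) {φ : F →+* F} (hφ : ∀ x, φ x = x ^ q)
    (hφφ : ∀ x, φ (φ x) = x) (hd : 0 < d) (hdq : d ≤ q) {G : MvPolynomial (Fin 5) F}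
    (hG : G.IsHomogeneous d) {W : Submodule F (Fin 5 → F)} (hW : Module.finrank F W = 3)
    (hGW : ∀ w ∈ W, eval w G = 0)
    (hG4 : ∀ V : Submodule F (Fin 5 → F), Module.finrank F V = 4 → ∃ v ∈ V, eval v G ≠ 0)
    (Z : Finset (Fin 5 → F)) (hZ : ∀ v ∈ Z, hermForm φ v v = 0 ∧ eval v G = 0) :
    Z.card + q ^ 3 ≤ q ^ 5 + q ^ 4 + (d - 1) * (q ^ 3 + q ^ 2) * (q ^ 4 - 1) := by
  classical
  have : Fintype ((Fin 5 → F) ⧸ W) := Fintype.ofFinite _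
  have h1 := card_isotropic_le hq hF hφ hφφ (by norm_num) hW (Z.filter (· ∈ W))
    (fun v hv => ⟨(Finset.mem_filter.1 hv).2, (hZ v (Finset.mem_filter.1 hv).1).1⟩)
  have hQ : (Finset.univ.erase (0 : (Fin 5 → F) ⧸ W)).card = q ^ 4 - 1 := by
    have h2 := W.finrank_quotient_add_finrank
    rw [hW, Module.finrank_fin_fun] at h2
    rw [Finset.card_erase_of_mem (Finset.mem_univ _), Finset.card_univ,
      Module.card_eq_pow_finrank (K := F), hF, ← pow_mul]
    congr 2
    omega
  have h2 : (Z.filter (¬ · ∈ W)).card ≤ (d - 1) * (q ^ 3 + q ^ 2) * (q ^ 4 - 1) := by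
    rw [← hQ]
    refine Finset.card_le_mul_card_image_of_maps_to (f := W.mkQ) (fun v hv => ?_) _
      (fun y hy => ?_)
    · rw [Finset.mem_erase]
      refine ⟨fun h => (Finset.mem_filter.1 hv).2 ?_, Finset.mem_univ _⟩
      rwa [Submodule.mkQ_apply, Submodule.Quotient.mk_eq_zero] at h
    · obtain ⟨u, rfl⟩ := W.mkQ_surjective y
      have hu : u ∉ W := by
        intro hu
        refine (Finset.mem_erase.1 hy).1 ?_
        rwa [Submodule.mkQ_apply, Submodule.Quotient.mk_eq_zero]
      refine card_coset_le hq hF hφ hφφ hd hdq hG hW hGW hu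
        (hG4 _ (by rw [finrank_span_singleton_sup W hu, hW])) _ fun v hv => ?_
      obtain ⟨hv1, hv2⟩ := Finset.mem_filter.1 hv
      refine ⟨?_, hZ v (Finset.mem_filter.1 hv1).1⟩
      rwa [Submodule.mkQ_apply, Submodule.mkQ_apply, Submodule.Quotient.eq] at hv2
  have h3 := Finset.card_filter_add_card_filter_not (s := Z) (· ∈ W)
  omega

theorem sq_sub_one_mul_ncard_lt {F : Type} [Field F] [Fintype F] {q : ℕ}
    (hF : Fintype.card F = q ^ 2) (S : Set (P4 F)) (Z : Finset (Fin 5 → F)) (hZ0 : 0 ∈ Z)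
    (hZ : ∀ x ∈ S, ∀ c : F, c • x.rep ∈ Z) : (q ^ 2 - 1) * S.ncard < Z.card := by
  classical
  have hS := Set.toFinite S
  have hmk : ∀ (c : Fˣ) (x : P4 F), Projectivization.mk F ((c : F) • x.rep)
      (smul_ne_zero c.ne_zero x.rep_nonzero) = x := by
    intro c x
    conv_rhs => rw [← x.mk_rep]
    rw [Projectivization.mk_eq_mk_iff']
    exact ⟨c, rfl⟩
  have h : (Finset.univ ×ˢ hS.toFinset : Finset (Fˣ × P4 F)).card ≤ (Z.erase 0).card := by
    refine Finset.card_le_card_of_injOn (fun t => (t.1 : F) • t.2.rep) (fun t ht => ?_)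
      (fun t _ t' _ h => ?_)
    · rw [Finset.mem_coe, Finset.mem_product, Set.Finite.mem_toFinset] at ht
      exact Finset.mem_coe.2 (Finset.mem_erase.2
        ⟨smul_ne_zero t.1.ne_zero t.2.rep_nonzero, hZ _ ht.2 _⟩)
    · have h' : (t.1 : F) • t.2.rep = (t'.1 : F) • t'.2.rep := h
      have h2 : t.2 = t'.2 := by
        rw [← hmk t.1 t.2, ← hmk t'.1 t'.2]
        congr 1
      rw [h2] at h'
      exact Prod.ext (Units.ext (smul_left_injective F t'.2.rep_nonzero h')) h2
  rw [Finset.card_product, Finset.card_univ, Fintype.card_units, hF,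
    ← Set.ncard_eq_toFinset_card S hS, Finset.card_erase_of_mem hZ0] at h
  have := Finset.card_pos.2 ⟨0, hZ0⟩
  omega

theorem eval_eq_zero_of_submodule_subset_VG {F : Type} [Field F] {d : ℕ} (hd : 0 < d)
    {G : MvPolynomial (Fin 5) F} (hG : G.IsHomogeneous d) {W : Submodule F (Fin 5 → F)}
    (h : {x : P4 F | x.submodule ≤ W} ⊆ VG G) {w : Fin 5 → F} (hw : w ∈ W) :
    eval w G = 0 := by
  by_cases h0 : w = 0
  · have := eval_smul_of_isHomogeneous hG 0 w
    rwa [zero_smul, zero_pow hd.ne', zero_mul, ← h0] at this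
  · have h1 : eval (Projectivization.mk F w h0).rep G = 0 := h (by
      change (Projectivization.mk F w h0).submodule ≤ W
      rw [Projectivization.submodule_mk, Submodule.span_singleton_le_iff_mem]
      exact hw)
    obtain ⟨a, ha⟩ := Projectivization.exists_smul_eq_mk_rep F w h0
    rw [← ha, Units.smul_def, eval_smul_of_isHomogeneous hG] at h1
    exact (mul_eq_zero.1 h1).resolve_left (pow_ne_zero d a.ne_zero)

theorem stmt6 (q : ℕ) (hq : IsPrimePow q)
    (F : Type) [Field F] [Fintype F] (hF : Fintype.card F = q ^ 2)
    (d : ℕ) (hd1 : 1 < d) (hdq : d ≤ q)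
    (G : MvPolynomial (Fin 5) F) (hG : G ≠ 0) (hGd : G.IsHomogeneous d)
    (hplane : ∃ S : Set (P4 F), IsPlane F S ∧ S ⊆ VG G)
    (hnohyp : ∀ S : Set (P4 F), IsHyperplane F S → ¬ S ⊆ VG G) :
    (VG G ∩ hermV3 q F).ncard ≤
        (d - 1) * q ^ 5 + (d - 1) * q ^ 4 + d * q ^ 3 + d * q ^ 2 + 1 ∧
      (VG G ∩ hermV3 q F).ncard < d * (q ^ 5 + q ^ 2) + q ^ 3 + 1 := by
  classical
  obtain ⟨φ, hφ, hφφ⟩ := exists_frobenius hq hF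
  have hq2 : 2 ≤ q := hq.two_le
  obtain ⟨_, ⟨W, hW, rfl⟩, hWG⟩ := hplane
  have hG4 : ∀ V : Submodule F (Fin 5 → F), Module.finrank F V = 4 → ∃ v ∈ V, eval v G ≠ 0 := by
    intro V hV
    obtain ⟨x, hx, hxG⟩ := Set.not_subset.1 (hnohyp _ ⟨V, hV, rfl⟩)
    exact ⟨x.rep, hx (x.submodule_eq ▸ Submodule.mem_span_singleton_self _), hxG⟩
  let Z : Finset (Fin 5 → F) :=
    Finset.univ.filter fun v => hermForm φ v v = 0 ∧ eval v G = 0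
  have h1 := card_isotropic_zeros_le hq2 hF hφ hφφ (by omega) hdq hGd hW
    (fun w hw => eval_eq_zero_of_submodule_subset_VG (by omega) hGd hWG hw) hG4 Z
    (fun v hv => (Finset.mem_filter.1 hv).2)
  have h2 := sq_sub_one_mul_ncard_lt hF (VG G ∩ hermV3 q F) Z
    (by simpa [Z] using eval_eq_zero_of_submodule_subset_VG (by omega) hGd hWG W.zero_mem) (by
      rintro x ⟨hxG, hxH⟩ c
      have hxG' : eval x.rep G = 0 := hxG
      have hxH' : ∑ i, x.rep i ^ (q + 1) = 0 := hxH
      refine Finset.mem_filter.2 ⟨Finset.mem_univ _, ?_, ?_⟩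
      · have : hermForm φ x.rep x.rep = 0 := by
          rw [← hxH', hermForm_apply]
          simp [hφ, pow_succ]
        simp [this]
      · rw [eval_smul_of_isHomogeneous hGd, hxG', mul_zero])
  obtain ⟨D, rfl⟩ : ∃ D, d = D + 1 := ⟨d - 1, by omega⟩
  rw [Nat.add_sub_cancel] at h1 ⊢
  have h3 : (VG G ∩ hermV3 q F).ncard ≤
      q ^ 3 + q ^ 2 + 1 + (q ^ 2 + 1) * (D * (q ^ 3 + q ^ 2)) := by
    obtain ⟨r, hr⟩ : ∃ r, q ^ 2 = r + 1 :=
      ⟨q ^ 2 - 1, (Nat.sub_add_cancel (Nat.one_le_pow _ _ (by omega))).symm⟩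
    have hr0 : 0 < r := by nlinarith
    have hq4 : q ^ 4 - 1 = r * (q ^ 2 + 1) := by
      have : q ^ 4 = r * (q ^ 2 + 1) + 1 := by
        rw [show q ^ 4 = q ^ 2 * q ^ 2 by ring, hr]
        ring
      omega
    have hr' : q ^ 2 - 1 = r := by omega
    rw [hq4] at h1
    rw [hr'] at h2
    refine Nat.le_of_mul_le_mul_left ?_ hr0
    have h5 : r * (q ^ 3 + q ^ 2 + 1) + q ^ 3 + 1 = q ^ 5 + q ^ 4 := by
      rw [show q ^ 5 = q ^ 2 * q ^ 3 by ring, show q ^ 4 = q ^ 2 * q ^ 2 by ring, hr]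
      ring
    have h6 : D * (q ^ 3 + q ^ 2) * (r * (q ^ 2 + 1)) =
      r * ((q ^ 2 + 1) * (D * (q ^ 3 + q ^ 2))) := by ring
    rw [Nat.mul_add]
    omega
  have h4 : D * q ^ 4 + D * q ^ 3 < q ^ 5 := by
    have h7 : (D + 1) * (q ^ 4 + q ^ 3) ≤ q * (q ^ 4 + q ^ 3) := Nat.mul_le_mul_right _ hdq
    have h8 : 0 < q ^ 3 := by positivity
    nlinarith
  constructor <;> nlinarith
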